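/- Let E be a nonempty open subset of ℝ^n, let φ : ℝ^n × [0,∞) → ℝ^n be continuous with φ(x,0) = x and φ(x,t+s) = φ(φ(x,t),s), and for x ∈ E set t_*(x) := inf{t > 0 : φ(x,t) ∈ ∂E} ∈ (0,∞]. Suppose w : E → ℝ is Borel measurable and, for each x ∈ E, the map t ↦ w(φ(x,t)) is absolutely continuous on [0, t_*(x)). Then there exists a Borel measurable function 𝒳w : E → ℝ such that for all x ∈ E and all t ∈ [0, t_*(x)): w(φ(x,t)) − w(x) = ∫_0^t 𝒳w(φ(x,s)) ds. (Lemma 8.1 of the paper.) -/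

import Mathlib

open MeasureTheory Set Filter Topology
open scoped ENNReal

noncomputable section

abbrev Rn (n : ℕ) : Type := EuclideanSpace ℝ (Fin n)

/-- The boundary hitting time of the flow, `inf {t > 0 : φ(x,t) ∈ ∂E}`, with `inf ∅ = ∞`. -/
def tstar {n : ℕ} (E : Set (Rn n)) (φ : Rn n → ℝ → Rn n) (x : Rn n) : ℝ≥0∞ :=
  ⨅ t ∈ {t : ℝ | 0 < t ∧ φ x t ∈ frontier E}, ENNReal.ofReal t

/-- A continuous semiflow started in an open set `E` stays in `E` strictly before the first
time it hits the boundary of `E`. -/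
theorem mem_of_ofReal_lt_tstar {n : ℕ} {E : Set (Rn n)} {φ : Rn n → ℝ → Rn n}
    (hE : IsOpen E) {x : Rn n} (hx : x ∈ E) (hφ0 : φ x 0 = x)
    (hφ : ContinuousOn (φ x) (Ici 0)) {t : ℝ} (ht : 0 ≤ t)
    (hlt : ENNReal.ofReal t < tstar E φ x) : φ x t ∈ E := by
  by_contra hnot
  have hpre : IsPreconnected (φ x '' Icc 0 t) :=
    isPreconnected_Icc.image _ (hφ.mono Icc_subset_Ici_self)
  have hcover : φ x '' Icc 0 t ⊆ E ∪ (closure E)ᶜ := by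
    rintro _ ⟨s, hs, rfl⟩
    by_contra hs'
    have hfr : φ x s ∈ frontier E := by
      rw [hE.frontier_eq]
      simp only [mem_union, mem_compl_iff, not_or, not_not] at hs'
      exact ⟨hs'.2, hs'.1⟩
    have hs0 : 0 < s := by
      rcases hs.1.eq_or_lt with rfl | h
      · exact absurd (Or.inl (by rwa [hφ0])) hs'
      · exact h
    have hle : tstar E φ x ≤ ENNReal.ofReal s := iInf₂_le s ⟨hs0, hfr⟩
    exact absurd (hle.trans (ENNReal.ofReal_le_ofReal hs.2)) hlt.not_ge
  have htE : φ x t ∈ (closure E)ᶜ :=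
    (hcover ⟨t, right_mem_Icc.2 ht, rfl⟩).resolve_left hnot
  obtain ⟨y, -, hyE, hyc⟩ := hpre E (closure E)ᶜ hE isClosed_closure.isOpen_compl hcover
    ⟨x, ⟨0, left_mem_Icc.2 ht, hφ0⟩, hx⟩ ⟨_, ⟨t, right_mem_Icc.2 ht, rfl⟩, htE⟩
  exact hyc (subset_closure hyE)

/-- The upper right derivative of the zero extension of `w` from `E` along the flow, taken along
the time steps `1 / (k + 1)`. -/
def flowDeriv {n : ℕ} (E : Set (Rn n)) (φ : Rn n → ℝ → Rn n) (w : Rn n → ℝ) (x : Rn n) : ℝ :=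
  limsup (fun k : ℕ => (1 / ((k : ℝ) + 1))⁻¹ *
    (E.indicator w (φ x (1 / ((k : ℝ) + 1))) - E.indicator w x)) atTop

theorem measurable_flowDeriv {n : ℕ} {E : Set (Rn n)} {φ : Rn n → ℝ → Rn n} {w : Rn n → ℝ}
    (hE : MeasurableSet E) (hw : Measurable fun x : E => w x.1)
    (hφ : ∀ t, 0 ≤ t → Measurable fun x => φ x t) : Measurable (flowDeriv E φ w) := by
  have hind : Measurable (E.indicator w) := by
    refine measurable_of_restrict_of_restrict_compl hE ?_ ?_
    · convert hw using 2 with x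
      exact indicator_of_mem x.2 w
    · convert measurable_const (a := (0 : ℝ)) using 2 with x
      exact indicator_of_notMem x.2 w
  exact Measurable.limsup fun k =>
    ((hind.comp (hφ _ (by positivity))).sub hind).const_mul _

/-- The flow derivative agrees with any derivative along the trajectory. -/
theorem flowDeriv_eq_of_hasDerivAt {n : ℕ} {E : Set (Rn n)} {φ : Rn n → ℝ → Rn n} {w : Rn n → ℝ}
    {x : Rn n} {s : ℝ} (hφsg : ∀ r ≥ (0 : ℝ), φ x (s + r) = φ (φ x s) r) {g : ℝ → ℝ} {d : ℝ}
    (hg : HasDerivAt g d s) (hmem : ∀ᶠ r in 𝓝 s, φ x r ∈ E)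
    (heq : ∀ᶠ r in 𝓝 s, w (φ x r) = g r) : flowDeriv E φ w (φ x s) = d := by
  have hstep : Tendsto (fun k : ℕ => 1 / ((k : ℝ) + 1)) atTop (𝓝 0) :=
    tendsto_one_div_add_atTop_nhds_zero_nat
  have hne : Tendsto (fun k : ℕ => 1 / ((k : ℝ) + 1)) atTop (𝓝[≠] 0) :=
    tendsto_nhdsWithin_iff.2 ⟨hstep, .of_forall fun k =>
      (Nat.one_div_pos_of_nat (α := ℝ) (n := k)).ne'⟩
  have hadd : Tendsto (fun k : ℕ => s + 1 / ((k : ℝ) + 1)) atTop (𝓝 s) := by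
    simpa using hstep.const_add s
  refine Tendsto.limsup_eq (((hasDerivAt_iff_tendsto_slope_zero.1 hg).comp hne).congr' ?_)
  filter_upwards [hadd.eventually hmem, hadd.eventually heq] with k hk hk'
  rw [← hφsg _ (by positivity), indicator_of_mem hk, indicator_of_mem hmem.self_of_nhds, hk',
    heq.self_of_nhds]
  rfl

/-- **Measurable derivative along the flow** (Lemma 8.1 of the paper).  If `w` is Borel
measurable on `E` and `t ↦ w(φ(x,t))` is absolutely continuous on `[0,t_*(x))` for each
`x ∈ E` (encoded by the existence, for each `x`, of a locally integrable density), then there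
is a single Borel measurable function `𝒳w` on `E` such that
`w(φ(x,t)) − w(x) = ∫_0^t 𝒳w(φ(x,s)) ds` for all `x ∈ E` and `t ∈ [0,t_*(x))`. -/
theorem measurable_derivative_along_flow {n : ℕ}
    (E : Set (Rn n)) (φ : Rn n → ℝ → Rn n)
    (hEopen : IsOpen E) (hEne : E.Nonempty)
    (hφcont : ContinuousOn (fun p : Rn n × ℝ => φ p.1 p.2) (Set.univ ×ˢ Set.Ici 0))
    (hφ0 : ∀ y, φ y 0 = y)
    (hφsg : ∀ y : Rn n, ∀ t ≥ (0:ℝ), ∀ s ≥ (0:ℝ), φ y (t + s) = φ (φ y t) s)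
    (w : Rn n → ℝ) (hwm : Measurable fun x : E => w x.1)
    (hAC : ∀ x ∈ E, ∃ d : ℝ → ℝ, ∀ t : ℝ, 0 ≤ t → ENNReal.ofReal t < tstar E φ x →
      IntervalIntegrable d volume 0 t ∧ w (φ x t) = w x + ∫ s in (0:ℝ)..t, d s) :
    ∃ Xw : Rn n → ℝ, Measurable (fun x : E => Xw x.1) ∧
      ∀ x ∈ E, ∀ t : ℝ, 0 ≤ t → ENNReal.ofReal t < tstar E φ x →
        IntervalIntegrable (fun s => Xw (φ x s)) volume 0 t ∧
        w (φ x t) - w x = ∫ s in (0:ℝ)..t, Xw (φ x s) := by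
  have htraj : ∀ x, ContinuousOn (φ x) (Ici 0) := fun x =>
    hφcont.comp (f := fun t : ℝ => (x, t)) (by fun_prop) fun t ht => ⟨mem_univ _, ht⟩
  have hmeas : ∀ t, 0 ≤ t → Measurable fun x => φ x t := fun t ht =>
    (hφcont.comp_continuous (f := fun x : Rn n => (x, t)) (by fun_prop)
      fun x => ⟨mem_univ _, ht⟩).measurable
  refine ⟨flowDeriv E φ w, (measurable_flowDeriv hEopen.measurableSet hwm hmeas).comp
    measurable_subtype_coe, fun x hx t ht htlt => ?_⟩
  obtain ⟨d, hd⟩ := hAC x hx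
  obtain ⟨hint, hwt⟩ := hd t ht htlt
  have hlt : ∀ r ≤ t, ENNReal.ofReal r < tstar E φ x := fun r hr =>
    (ENNReal.ofReal_le_ofReal hr).trans_lt htlt
  have hae : ∀ᵐ s, s ∈ uIoc 0 t → d s = flowDeriv E φ w (φ x s) := by
    filter_upwards [hint.ae_hasDerivAt_integral, Measure.ae_ne volume t] with s hs hst hmem
    rw [uIoc_of_le ht] at hmem
    rw [uIcc_of_le ht] at hs
    have hnhds : Ioo 0 t ∈ 𝓝 s := Ioo_mem_nhds hmem.1 (hmem.2.lt_of_ne hst)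
    have hder := (hs (Ioc_subset_Icc_self hmem) 0 (left_mem_Icc.2 ht)).const_add (w x)
    refine (flowDeriv_eq_of_hasDerivAt (hφsg x s hmem.1.le) hder ?_ ?_).symm
    · filter_upwards [hnhds] with r hr
      exact mem_of_ofReal_lt_tstar hEopen hx (hφ0 x) (htraj x) hr.1.le (hlt r hr.2.le)
    · filter_upwards [hnhds] with r hr
      exact (hd r hr.1.le (hlt r hr.2.le)).2
  refine ⟨hint.congr_ae ((ae_restrict_iff' measurableSet_uIoc).2 hae), ?_⟩
  rw [← intervalIntegral.integral_congr_ae hae, hwt, add_sub_cancel_left]
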